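/- Let N ≥ 0, let α₀, α₁, ..., α_N ∈ ℝ with m ≤ α₀/2 ≤ M for positive constants m, M and |α_k| ≤ K for all k ≤ N, and for each y ∈ ℝ define, taking basepoint x̄ = y, the functions G⁰(t,x;T,y) := (2π α₀ (T−t))^{−1/2} exp( −( x − y − α₀(T−t)/2 )² / ( 2 α₀ (T−t) ) ) and recursively G^n(t,x;T,y) := Σ_{h=1}^{n} α_h ∫_t^T ∫_ℝ G⁰(t,x;s,η) (η − y)^h ( ∂_{ηη} − ∂_η ) G^{n−h}(s,η;T,y) dη ds for 1 ≤ n ≤ N. Then for any ε > 0 and τ > 0 there exists a constant C > 0, depending only on ε, τ, m, M, N and K, such that for every n ≤ N, x, y ∈ ℝ and 0 < T − t ≤ τ: | ∂_{xx} G^n(t,x;T,y) | ≤ C (T−t)^{(n−2)/2} Γ̄^{M+ε}(t,x;T,y), where Γ̄^{c}(t,x;T,y) := (4π c (T−t))^{−1/2} exp( −(x−y)² / (4c(T−t)) ) denotes the Gaussian fundamental solution of the heat operator c ∂_{xx} + ∂_t. -/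

import Mathlib

open Filter Topology Set MeasureTheory intervalIntegral

noncomputable section

/-- The Gaussian fundamental solution of `L₀ = (c/2)(∂_{xx} - ∂_x) + ∂_t` :
`gaussK c t x v y = (2πc(v-t))^{-1/2} exp(-(x - y - c(v-t)/2)²/(2c(v-t)))`. -/
def gaussK (c : ℝ) (t x v y : ℝ) : ℝ :=
  (Real.sqrt (2 * Real.pi * (c * (v - t))))⁻¹ *
    Real.exp (-(x - y - c * (v - t) / 2)^2 / (2 * c * (v - t)))

/-- The Gaussian fundamental solution `Γ̄^c` of the heat operator `c∂_{xx} + ∂_t`. -/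
def heatKer (c : ℝ) (t x v y : ℝ) : ℝ :=
  (Real.sqrt (4 * Real.pi * c * (v - t)))⁻¹ *
    Real.exp (-(x - y)^2 / (4 * c * (v - t)))

def gk (a w u : ℝ) : ℝ :=
  (Real.sqrt (2 * Real.pi * (a * w)))⁻¹ * Real.exp (-(u - a * w / 2)^2 / (2 * a * w))

inductive GRep (S : Set (ℕ → ℝ)) : ℤ → ((ℕ → ℝ) → ℝ → ℝ → ℝ) → Prop
  | zero (d : ℤ) : GRep S d (fun _ _ _ => 0)
  | mono (d : ℤ) (c : (ℕ → ℝ) → ℝ) (k : ℕ) (j : ℤ) (B : ℝ) (hc : ∀ α ∈ S, |c α| ≤ B)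
      (hd : d ≤ k + 2 * j) : GRep S d (fun α w u => c α * u ^ k * w ^ j)
  | add (d : ℤ) (F F' : (ℕ → ℝ) → ℝ → ℝ → ℝ) : GRep S d F → GRep S d F' →
      GRep S d (fun α w u => F α w u + F' α w u)

variable {S : Set (ℕ → ℝ)}

lemma GRep.le {d d' : ℤ} {F} (h : GRep S d F) (hd : d' ≤ d) : GRep S d' F := by
  induction h with
  | zero => exact .zero _
  | mono c k j B hc h => exact .mono _ c k j B hc (hd.trans h)
  | add F F' _ _ h1 h2 => exact .add _ _ _ h1 h2

lemma GRep.smul {d : ℤ} {F} (h : GRep S d F) (b : (ℕ → ℝ) → ℝ) (B : ℝ) (hb : ∀ α ∈ S, |b α| ≤ B) :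
    GRep S d (fun α w u => b α * F α w u) := by
  induction h with
  | zero => simpa using GRep.zero d
  | mono c k j B' hc h =>
    have := GRep.mono (S := S) d (fun α => b α * c α) k j (B * B') (fun α hα => by
      rw [abs_mul]
      exact mul_le_mul (hb α hα) (hc α hα) (abs_nonneg _) ((abs_nonneg _).trans (hb α hα))) h
    simpa [mul_assoc] using this
  | add F F' _ _ h1 h2 => simpa [mul_add] using GRep.add _ _ _ h1 h2

lemma GRep.sub {d : ℤ} {F F'} (h : GRep S d F) (h' : GRep S d F') :
    GRep S d (fun α w u => F α w u - F' α w u) := by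
  have := GRep.add _ _ _ h (h'.smul (fun _ => -1) 1 (by simp))
  simpa [sub_eq_add_neg] using this

lemma GRep.sum {ι : Type*} (s : Finset ι) {d : ℤ} (F : ι → (ℕ → ℝ) → ℝ → ℝ → ℝ)
    (h : ∀ i ∈ s, GRep S d (F i)) : GRep S d (fun α w u => ∑ i ∈ s, F i α w u) := by
  classical
  induction s using Finset.induction_on with
  | empty => simpa using GRep.zero d
  | insert i s hi ih =>
    simp only [Finset.sum_insert hi]
    exact .add _ _ _ (h _ (by simp)) (ih fun j hj => h _ (by simp [hj]))

lemma GRep.mul_pow {d : ℤ} {F} (h : GRep S d F) (n : ℕ) :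
    GRep S (d + n) (fun α w u => u ^ n * F α w u) := by
  induction h with
  | zero => simpa using GRep.zero _
  | mono c k j B hc h =>
    have := GRep.mono (S := S) (d + n) c (k + n) j B hc (by push_cast; linarith)
    convert! this using 4
    ring
  | add F F' _ _ h1 h2 => simpa [mul_add] using GRep.add _ _ _ h1 h2

lemma gk_deriv {a w : ℝ} (ha : 0 < a) (hw : 0 < w) (u : ℝ) :
    HasDerivAt (gk a w) ((1 / 2 - u / (a * w)) * gk a w u) u := by
  unfold gk
  have h1 : HasDerivAt (fun u : ℝ => -(u - a * w / 2)^2 / (2 * a * w))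
      (1 / 2 - u / (a * w)) u := by
    have := ((((hasDerivAt_id u).sub_const (a * w / 2)).pow 2).neg).div_const (2 * a * w)
    convert! this using 1
    simp
    field_simp
    ring
  have := (h1.exp).const_mul (Real.sqrt (2 * Real.pi * (a * w)))⁻¹
  convert! this using 1
  ring

lemma GRep.deriv {m : ℝ} (hm : 0 < m) (hS : ∀ α ∈ S, m ≤ α 0 / 2) {d : ℤ} {F} (h : GRep S d F) :
    ∃ F', GRep S (d - 1) F' ∧ ∀ α ∈ S, ∀ w > 0, ∀ u,
      HasDerivAt (fun u => F α w u * gk (α 0) w u) (F' α w u * gk (α 0) w u) u := by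
  induction h with
  | zero => exact ⟨_, GRep.zero _, fun α _ w _ u => by simpa using hasDerivAt_const u (0:ℝ)⟩
  | mono c k j B hc h =>
    have r1 : GRep S (d - 1) (fun α w u => (k : ℝ) * (c α * u ^ (k - 1) * w ^ j)) := by
      rcases k with _ | k
      · simpa using GRep.zero _
      · refine GRep.smul (GRep.mono _ c k j B hc (by push_cast at h; linarith)) (fun _ => _)
          |((k + 1 : ℕ) : ℝ)| (fun _ _ => le_rfl)
    have r2 : GRep S (d - 1) (fun α w u => (1 / 2 : ℝ) * (c α * u ^ k * w ^ j)) :=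
      GRep.smul (GRep.mono _ c k j B hc (by linarith)) (fun _ => _) (1/2)
        (fun _ _ => by norm_num [abs_of_pos])
    have r3 : GRep S (d - 1) (fun α w u => (1 / α 0) * (c α * u ^ (k + 1) * w ^ (j - 1))) :=
      GRep.smul (GRep.mono _ c _ _ B hc (by push_cast; linarith)) (fun α => 1 / α 0) (1 / (2 * m))
        (fun α hα => by
          have := hS α hα
          rw [abs_of_pos (by apply one_div_pos.2; linarith)]
          exact one_div_le_one_div_of_le (by linarith) (by linarith))
    refine ⟨_, (r1.add _ _ _ r2).sub r3, fun α hα w hw u => ?_⟩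
    have ha : 0 < α 0 := by have := hS α hα; linarith
    have := (((hasDerivAt_pow k u).const_mul (c α)).mul_const (w ^ j)).mul (gk_deriv ha hw u)
    convert! this using 1
    rw [zpow_sub_one₀ hw.ne']
    field_simp
    ring
  | add F F' _ _ h1 h2 =>
    obtain ⟨D1, r1, h1⟩ := h1
    obtain ⟨D2, r2, h2⟩ := h2
    refine ⟨_, r1.add _ _ _ r2, fun α hα w hw u => ?_⟩
    have := (h1 α hα w hw u).add (h2 α hα w hw u)
    convert! this using 1
    · ext u; simp; ring
    · ring

open ProbabilityTheory in
lemma gk_prod {a σ w : ℝ} (ha : 0 < a) (hw : 0 < w) (hσ : w < σ) (u v : ℝ) :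
    gk a (σ - w) (u - v) * gk a w v =
      gk a σ u * gaussianPDFReal (u * w / σ) (Real.toNNReal (a * w * (σ - w) / σ)) v := by
  have h1 : 0 < σ - w := sub_pos.2 hσ
  have h2 : 0 < σ := hw.trans hσ
  have h3 : 0 < a * w * (σ - w) / σ := by positivity
  unfold gk gaussianPDFReal
  rw [Real.coe_toNNReal _ h3.le]
  have e1 : (√(2 * Real.pi * (a * (σ - w))))⁻¹ * (√(2 * Real.pi * (a * w)))⁻¹ =
      (√(2 * Real.pi * (a * σ)))⁻¹ * (√(2 * Real.pi * (a * w * (σ - w) / σ)))⁻¹ := by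
    rw [← mul_inv, ← mul_inv, ← Real.sqrt_mul (by positivity), ← Real.sqrt_mul (by positivity)]
    congr 2
    field_simp
  have e2 : -(u - v - a * (σ - w) / 2) ^ 2 / (2 * a * (σ - w)) + -(v - a * w / 2) ^ 2 / (2 * a * w)
      = -(u - a * σ / 2) ^ 2 / (2 * a * σ) + -(v - u * w / σ) ^ 2 / (2 * (a * w * (σ - w) / σ)) := by
    have := h1.ne'
    field_simp
    ring
  calc _ = ((√(2 * Real.pi * (a * (σ - w))))⁻¹ * (√(2 * Real.pi * (a * w)))⁻¹) *
      (Real.exp (-(u - v - a * (σ - w) / 2) ^ 2 / (2 * a * (σ - w))) *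
        Real.exp (-(v - a * w / 2) ^ 2 / (2 * a * w))) := by ring
    _ = _ := by
      rw [← Real.exp_add, e1, e2, Real.exp_add]; ring

open ProbabilityTheory in
def mom (i : ℕ) : ℝ := ∫ z, z ^ i ∂(gaussianReal 0 1)

open ProbabilityTheory in
lemma integrable_pow_gaussian (μ : ℝ) (v : NNReal) (i : ℕ) :
    Integrable (fun z : ℝ => z ^ i) (gaussianReal μ v) := by
  rcases eq_or_ne i 0 with rfl | hi
  · simp
  have := (memLp_id_gaussianReal (μ := μ) (v := v) (i : NNReal)).integrable_norm_rpow
    (by simpa using hi) (by simp)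
  refine this.mono' (by fun_prop) (Eventually.of_forall fun z => by simp)

open ProbabilityTheory in
lemma mom_odd {i : ℕ} (hi : Odd i) : mom i = 0 := by
  have h : mom i = - mom i := by
    conv_lhs => rw [mom, ← neg_zero, ← gaussianReal_map_neg]
    rw [integral_map (by fun_prop) (by fun_prop), mom, ← MeasureTheory.integral_neg]
    simp [hi.neg_pow]
  linarith

open ProbabilityTheory in
lemma gaussian_moment (μ V : ℝ) (hV : 0 < V) (k : ℕ) :
    ∫ v, v ^ k * gaussianPDFReal μ V.toNNReal v =
      ∑ i ∈ Finset.range (k + 1), k.choose i * mom i * μ ^ (k - i) * V ^ (i / 2) := by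
  have hne : V.toNNReal ≠ 0 := by simpa using hV
  have e : gaussianReal μ V.toNNReal = (gaussianReal 0 1).map (fun z => √V * z + μ) := by
    have : (fun z => √V * z + μ) = (fun z => z + μ) ∘ (fun z => √V * z) := rfl
    rw [this, ← Measure.map_map (by fun_prop) (by fun_prop), gaussianReal_map_const_mul,
      gaussianReal_map_add_const]
    congr 1
    · simp
    · ext; simp [hV.le]
  have e1 : ∫ v, v ^ k * gaussianPDFReal μ V.toNNReal v = ∫ v, v ^ k ∂gaussianReal μ V.toNNReal := by
    rw [integral_gaussianReal_eq_integral_smul hne]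
    simp [mul_comm]
  rw [e1, e, integral_map (by fun_prop) (by fun_prop)]
  simp only [add_pow]
  rw [MeasureTheory.integral_finsetSum]
  · refine Finset.sum_congr rfl fun i hi => ?_
    have : ∀ z : ℝ, (√V * z) ^ i * μ ^ (k - i) * (k.choose i) =
      (√V ^ i * μ ^ (k - i) * (k.choose i)) * z ^ i := fun z => by ring
    simp only [this]
    rw [MeasureTheory.integral_const_mul]
    change _ * mom i = _
    rcases Nat.even_or_odd i with hi | hi
    · obtain ⟨l, rfl⟩ := hi
      have : √V ^ (l + l) = V ^ l := by rw [← two_mul, pow_mul, Real.sq_sqrt hV.le]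
      rw [this, show (l + l) / 2 = l by omega]; ring
    · simp [mom_odd hi]
  · intro i hi
    have : ∀ z : ℝ, (√V * z) ^ i * μ ^ (k - i) * (k.choose i) =
      (√V ^ i * μ ^ (k - i) * (k.choose i)) * z ^ i := fun z => by ring
    simp only [this]
    exact (integrable_pow_gaussian _ _ _).const_mul _

open ProbabilityTheory in
lemma gaussian_pow_integrable (μ V : ℝ) (hV : 0 < V) (k : ℕ) :
    Integrable (fun v => v ^ k * gaussianPDFReal μ V.toNNReal v) := by
  have hne : V.toNNReal ≠ 0 := by simpa using hV
  have := integrable_pow_gaussian μ V.toNNReal k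
  rw [gaussianReal_of_var_ne_zero _ hne, integrable_withDensity_iff (by fun_prop)
    (by simp [gaussianPDF])] at this
  simpa using this

def betaI (p q : ℕ) : ℝ := ∫ x in (0:ℝ)..1, x ^ p * (1 - x) ^ q

lemma beta_int (σ : ℝ) (p q : ℕ) :
    ∫ w in (0:ℝ)..σ, w ^ p * (σ - w) ^ q = σ ^ (p + q + 1) * betaI p q := by
  have := intervalIntegral.mul_integral_comp_mul_left (a := 0) (b := 1) (c := σ)
    (f := fun w => w ^ p * (σ - w) ^ q)
  simp only [mul_zero, mul_one] at this
  rw [← this, betaI, pow_succ (σ : ℝ), mul_comm _ σ, mul_assoc]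
  congr 1
  rw [← intervalIntegral.integral_const_mul]
  refine intervalIntegral.integral_congr (E := ℝ) fun x _ => ?_
  beta_reduce
  rw [show σ - σ * x = σ * (1 - x) by ring, mul_pow, mul_pow]
  ring

def pex (k : ℕ) (j : ℤ) (i : ℕ) : ℕ := ((k : ℤ) - i + (i / 2 : ℕ) + j).toNat

lemma duhamel_term {a σ w u : ℝ} (hw : 0 < w) (hσ : 0 < σ) (k i l : ℕ) (j : ℤ)
    (hd : -1 ≤ (k : ℤ) + 2 * j) (hi : i ≤ k) (hl : i = l + l) :
    w ^ j * ((u * w / σ) ^ (k - i) * (a * w * (σ - w) / σ) ^ l) =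
      u ^ (k - i) * a ^ l * σ ^ (-((k : ℤ) - i) - l) * (w ^ pex k j i * (σ - w) ^ l) := by
  have h1 : (w : ℝ) ^ pex k j i = w ^ (k - i) * w ^ l * w ^ j := by
    rw [← zpow_natCast, ← zpow_natCast, ← zpow_natCast, ← zpow_add₀ hw.ne', ← zpow_add₀ hw.ne']
    congr 1
    unfold pex
    rw [Nat.cast_sub hi]
    omega
  have h2 : σ ^ (-((k : ℤ) - i) - l) = (σ ^ (k - i))⁻¹ * (σ ^ l)⁻¹ := by
    rw [← zpow_natCast, ← zpow_natCast, ← zpow_neg, ← zpow_neg, ← zpow_add₀ hσ.ne',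
      Nat.cast_sub hi]
    congr 1
  rw [h1, h2]
  simp only [mul_pow, div_eq_mul_inv]
  ring

def dcoef (k : ℕ) (j : ℤ) (i : ℕ) : ℝ := k.choose i * mom i * betaI (pex k j i) (i / 2)

lemma duhamel_mono {a : ℝ} (ha : 0 < a) (k : ℕ) (j : ℤ) (hd : -1 ≤ (k : ℤ) + 2 * j)
    {σ : ℝ} (hσ : 0 < σ) (u : ℝ) :
    (∀ w ∈ Ioo 0 σ, Integrable (fun v => gk a (σ - w) (u - v) * (v ^ k * w ^ j * gk a w v))) ∧
    IntegrableOn (fun w => ∫ v, gk a (σ - w) (u - v) * (v ^ k * w ^ j * gk a w v)) (Ioo 0 σ) ∧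
    ∫ w in Ioo 0 σ, ∫ v, gk a (σ - w) (u - v) * (v ^ k * w ^ j * gk a w v) =
      (∑ i ∈ Finset.range (k + 1), dcoef k j i * (a ^ (i / 2) * u ^ (k - i) *
        σ ^ (((i / 2 : ℕ) : ℤ) + j + 1))) * gk a σ u := by
  have e : ∀ w ∈ Ioo 0 σ, ∀ v, gk a (σ - w) (u - v) * (v ^ k * w ^ j * gk a w v) =
      (gk a σ u * w ^ j) * (v ^ k * ProbabilityTheory.gaussianPDFReal (u * w / σ)
        (Real.toNNReal (a * w * (σ - w) / σ)) v) := by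
    intro w hw v
    calc _ = (gk a (σ - w) (u - v) * gk a w v) * (v ^ k * w ^ j) := by ring
      _ = _ := by rw [gk_prod ha hw.1 hw.2]; ring
  have hV : ∀ w ∈ Ioo 0 σ, 0 < a * w * (σ - w) / σ := fun w hw => by
    have := hw.1
    have := sub_pos.2 hw.2
    positivity
  have inner : ∀ w ∈ Ioo 0 σ, ∫ v, gk a (σ - w) (u - v) * (v ^ k * w ^ j * gk a w v) =
      ∑ i ∈ Finset.range (k + 1), (gk a σ u * (k.choose i * mom i) * (u ^ (k - i) * a ^ (i / 2) *
        σ ^ (-((k : ℤ) - i) - (i / 2 : ℕ)))) * (w ^ pex k j i * (σ - w) ^ (i / 2)) := by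
    intro w hw
    rw [integral_congr_ae (Eventually.of_forall (e w hw)), MeasureTheory.integral_const_mul,
      gaussian_moment _ _ (hV w hw), Finset.mul_sum]
    refine Finset.sum_congr rfl fun i hi => ?_
    rcases Nat.even_or_odd i with he | ho
    · obtain ⟨l, hl⟩ := he
      have hl2 : i / 2 = l := by omega
      rw [hl2]
      have := duhamel_term (a := a) (u := u) hw.1 hσ k i l j hd (by simpa [Nat.lt_succ_iff] using hi) hl
      linear_combination (gk a σ u * (k.choose i * mom i)) * this
    · simp [mom_odd ho]
  have hint : ∀ i, IntervalIntegrable (fun w => (gk a σ u * (k.choose i * mom i) * (u ^ (k - i) * a ^ (i / 2) *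
        σ ^ (-((k : ℤ) - i) - (i / 2 : ℕ)))) * (w ^ pex k j i * (σ - w) ^ (i / 2))) volume 0 σ := fun i =>
    Continuous.intervalIntegrable (by fun_prop) _ _
  refine ⟨fun w hw => ?_, ?_, ?_⟩
  · simp only [e w hw]
    exact (gaussian_pow_integrable _ _ (hV w hw) k).const_mul _
  · rw [integrableOn_congr_fun inner measurableSet_Ioo]
    have := Continuous.integrableOn_Icc (μ := volume) (a := 0) (b := σ) (f := fun w : ℝ =>
      ∑ i ∈ Finset.range (k + 1), (gk a σ u * (k.choose i * mom i) * (u ^ (k - i) * a ^ (i / 2) *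
        σ ^ (-((k : ℤ) - i) - (i / 2 : ℕ)))) * (w ^ pex k j i * (σ - w) ^ (i / 2))) (by fun_prop)
    exact this.mono_set Ioo_subset_Icc_self
  · rw [setIntegral_congr_fun measurableSet_Ioo inner, ← integral_Ioc_eq_integral_Ioo,
      ← intervalIntegral.integral_of_le hσ.le, intervalIntegral.integral_finsetSum (fun i _ => hint i),
      Finset.sum_mul]
    refine Finset.sum_congr rfl fun i hi => ?_
    rw [intervalIntegral.integral_const_mul, beta_int, dcoef]
    rcases Nat.even_or_odd i with he | ho
    · have hi : i ≤ k := by simpa [Nat.lt_succ_iff] using hi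
      have : σ ^ (-((k : ℤ) - i) - (i / 2 : ℕ)) * σ ^ (pex k j i + i / 2 + 1) =
          σ ^ (((i / 2 : ℕ) : ℤ) + j + 1) := by
        rw [← zpow_natCast, ← zpow_add₀ hσ.ne']
        congr 1
        have : (pex k j i : ℤ) = (k : ℤ) - i + (i / 2 : ℕ) + j := by
          unfold pex
          obtain ⟨l, hl⟩ := he
          omega
        push_cast at this ⊢
        rw [this]
        obtain ⟨l, hl⟩ := he
        omega
      rw [← this]
      ring
    · simp [mom_odd ho]

lemma GRep.duhamel {m M : ℝ} (hm : 0 < m) (hS : ∀ α ∈ S, m ≤ α 0 / 2)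
    (hS' : ∀ α ∈ S, α 0 / 2 ≤ M) {d : ℤ} (hd : -1 ≤ d) {F} (h : GRep S d F) :
    ∃ F', GRep S (d + 2) F' ∧ ∀ α ∈ S, ∀ σ > 0, ∀ u,
    (∀ w ∈ Ioo 0 σ, Integrable (fun v => gk (α 0) (σ - w) (u - v) * (F α w v * gk (α 0) w v))) ∧
    IntegrableOn (fun w => ∫ v, gk (α 0) (σ - w) (u - v) * (F α w v * gk (α 0) w v)) (Ioo 0 σ) ∧
    ∫ w in Ioo 0 σ, ∫ v, gk (α 0) (σ - w) (u - v) * (F α w v * gk (α 0) w v) =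
      F' α σ u * gk (α 0) σ u := by
  induction h with
  | zero => exact ⟨_, GRep.zero _, fun α _ σ _ u => by simp⟩
  | mono c k j B hc h =>
    have hr : GRep S (d + 2) (fun α σ u => c α * ∑ i ∈ Finset.range (k + 1), dcoef k j i *
        ((α 0) ^ (i / 2) * u ^ (k - i) * σ ^ (((i / 2 : ℕ) : ℤ) + j + 1))) := by
      refine GRep.smul (GRep.sum _ _ fun i hi => ?_) c B hc
      rcases Nat.even_or_odd i with he | ho
      · have hi : i ≤ k := by simpa [Nat.lt_succ_iff] using hi
        refine GRep.smul ?_ (fun _ => dcoef k j i) |dcoef k j i| (fun _ _ => le_rfl)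
        refine GRep.mono _ (fun α => (α 0) ^ (i / 2)) (k - i) _ ((2 * M) ^ (i / 2)) ?_ ?_
        · intro α hα
          have h1 := hS α hα
          have h2 := hS' α hα
          rw [abs_of_pos (pow_pos (by linarith) _)]
          exact pow_le_pow_left₀ (by linarith) (by linarith) _
        · obtain ⟨l, hl⟩ := he
          push_cast [Nat.cast_sub hi]
          omega
      · simpa [dcoef, mom_odd ho] using GRep.zero (S := S) (d + 2)
    refine ⟨_, hr, fun α hα σ hσ u => ?_⟩
    have ha : 0 < α 0 := by have := hS α hα; linarith
    obtain ⟨h1, h2, h3⟩ := duhamel_mono ha k j (hd.trans h) hσ u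
    have e : ∀ w v, gk (α 0) (σ - w) (u - v) * (c α * v ^ k * w ^ j * gk (α 0) w v) =
      c α * (gk (α 0) (σ - w) (u - v) * (v ^ k * w ^ j * gk (α 0) w v)) := fun w v => by ring
    simp only [e, MeasureTheory.integral_const_mul]
    refine ⟨fun w hw => (h1 w hw).const_mul _, h2.const_mul _, ?_⟩
    rw [h3]; ring
  | add F F' _ _ h1 h2 =>
    obtain ⟨D1, r1, h1⟩ := h1
    obtain ⟨D2, r2, h2⟩ := h2
    refine ⟨_, r1.add _ _ _ r2, fun α hα σ hσ u => ?_⟩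
    obtain ⟨a1, a2, a3⟩ := h1 α hα σ hσ u
    obtain ⟨b1, b2, b3⟩ := h2 α hα σ hσ u
    have e : ∀ w ∈ Ioo 0 σ, ∫ v, gk (α 0) (σ - w) (u - v) * ((F α w v + F' α w v) * gk (α 0) w v) =
      (∫ v, gk (α 0) (σ - w) (u - v) * (F α w v * gk (α 0) w v)) +
       ∫ v, gk (α 0) (σ - w) (u - v) * (F' α w v * gk (α 0) w v) := by
      intro w hw
      rw [← MeasureTheory.integral_add (a1 w hw) (b1 w hw)]
      simp only [mul_add, add_mul]
    refine ⟨fun w hw => ?_, ?_, ?_⟩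
    · simp only [mul_add, add_mul]
      exact (a1 w hw).add (b1 w hw)
    · rw [integrableOn_congr_fun e measurableSet_Ioo]
      exact a2.add b2
    · rw [setIntegral_congr_fun measurableSet_Ioo e, MeasureTheory.integral_add a2 b2, a3, b3]
      ring

def hk (c w u : ℝ) : ℝ := (Real.sqrt (4 * Real.pi * c * w))⁻¹ * Real.exp (-u ^ 2 / (4 * c * w))

lemma pow_exp_bound (k : ℕ) {δ b z : ℝ} (hδ : 0 < δ) (hz : 0 ≤ z) :
    z ^ k * Real.exp (-δ * z ^ 2 + b * z) ≤ k.factorial * Real.exp ((b + 1) ^ 2 / (4 * δ)) := by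
  have h1 : z ^ k ≤ k.factorial * Real.exp z := by
    have := Real.pow_div_factorial_le_exp z hz k
    rwa [div_le_iff₀ (by positivity), mul_comm] at this
  calc _ ≤ (k.factorial * Real.exp z) * Real.exp (-δ * z ^ 2 + b * z) := by gcongr
    _ = k.factorial * Real.exp (z + (-δ * z ^ 2 + b * z)) := by
      rw [Real.exp_add z]; ring
    _ ≤ _ := by
      gcongr
      rw [le_div_iff₀ (by positivity)]
      nlinarith [sq_nonneg (2 * δ * z - (b + 1))]

lemma bound_mono {m M ε τ : ℝ} (hm : 0 < m) (hmM : m ≤ M) (hε : 0 < ε) (hτ : 0 < τ)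
    (k : ℕ) (j d : ℤ) (hd : d ≤ k + 2 * j) :
    ∃ C : ℝ, 0 ≤ C ∧ ∀ a w u : ℝ, m ≤ a / 2 → a / 2 ≤ M → 0 < w → w ≤ τ →
      |u| ^ k * w ^ j * gk a w u ≤ C * w ^ ((d : ℝ) / 2) * hk (M + ε) w u := by
  have hM : 0 < M := hm.trans_le hmM
  set c := M + ε with hc
  have hc0 : 0 < c := by positivity
  set δ := 1 / (4 * M) - 1 / (4 * c) with hδd
  have hδ : 0 < δ := by
    rw [hδd, sub_pos]
    apply one_div_lt_one_div_of_lt <;> linarith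
  set A := (k.factorial : ℝ) * Real.exp ((√τ / 2 + 1) ^ 2 / (4 * δ)) with hA
  set B := τ ^ (((k : ℝ) + 2 * j - d) / 2) with hB
  have hA0 : 0 ≤ A := by positivity
  have hB0 : 0 ≤ B := by positivity
  refine ⟨√(c / m) * A * B, by positivity, fun a w u h1 h2 hw hwτ => ?_⟩
  have ha : 0 < a := by linarith
  set z := |u| / √w with hz
  have hsw : 0 < √w := Real.sqrt_pos.2 hw
  have hz0 : 0 ≤ z := by positivity
  have hu : |u| = z * √w := by rw [hz]; field_simp
  have hu2 : u ^ 2 = z ^ 2 * w := by rw [← sq_abs, hu, mul_pow, Real.sq_sqrt hw.le]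
  -- prefactor
  have hpre : (√(2 * Real.pi * (a * w)))⁻¹ ≤ √(c / m) * (√(4 * Real.pi * c * w))⁻¹ := by
    have : 4 * Real.pi * c * w = (c / m) * (4 * Real.pi * m * w) := by field_simp
    have hq : √(c / m) ≠ 0 := (Real.sqrt_pos.2 (by positivity)).ne'
    have hs : √(4 * Real.pi * c * w) = √(c / m) * √(4 * Real.pi * m * w) := by
      rw [this]
      exact Real.sqrt_mul (by positivity) _
    rw [hs, mul_inv, mul_inv_cancel_left₀ hq]
    apply inv_anti₀ (by positivity)
    apply Real.sqrt_le_sqrt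
    have : 0 ≤ Real.pi * w := by positivity
    nlinarith
  -- exponential
  have hexp : Real.exp (-(u - a * w / 2) ^ 2 / (2 * a * w)) ≤
      Real.exp (-δ * z ^ 2 + √τ / 2 * z) * Real.exp (-u ^ 2 / (4 * c * w)) := by
    rw [← Real.exp_add]
    apply Real.exp_le_exp.2
    have e1 : -(u - a * w / 2) ^ 2 / (2 * a * w) = -(z ^ 2 / (2 * a)) + u / 2 - a * w / 8 := by
      have : -(u - a * w / 2) ^ 2 / (2 * a * w) = -(u ^ 2 / (2 * a * w)) + u / 2 - a * w / 8 := by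
        field_simp
        ring
      rw [this, hu2]
      field_simp
    have e2 : -u ^ 2 / (4 * c * w) = - (1 / (4 * c)) * z ^ 2 := by
      rw [hu2]; field_simp
    have e3 : z ^ 2 / (4 * M) ≤ z ^ 2 / (2 * a) := by
      apply div_le_div_of_nonneg_left (by positivity) (by positivity) (by linarith)
    have e4 : u ≤ z * √τ := (le_abs_self u).trans (by rw [hu]; gcongr)
    have e5 : z ^ 2 / (4 * M) = 1 / (4 * M) * z ^ 2 := by ring
    have e6 : 0 ≤ a * w / 8 := by positivity
    rw [e1, e2, hδd]
    nlinarith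
  have hpow : √w ^ k * w ^ j ≤ B * w ^ ((d : ℝ) / 2) := by
    have : √w ^ k * w ^ j = w ^ (((k : ℝ) + 2 * j - d) / 2) * w ^ ((d : ℝ) / 2) := by
      rw [Real.sqrt_eq_rpow, ← Real.rpow_natCast, ← Real.rpow_mul hw.le, ← Real.rpow_intCast,
        ← Real.rpow_add hw, ← Real.rpow_add hw]
      congr 1
      ring
    rw [this, hB]
    have hd' : (d : ℝ) ≤ k + 2 * j := by exact_mod_cast hd
    gcongr
  have hzb := pow_exp_bound k (b := √τ / 2) hδ hz0
  rw [← hA] at hzb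
  unfold gk hk
  calc |u| ^ k * w ^ j * ((√(2 * Real.pi * (a * w)))⁻¹ * Real.exp (-(u - a * w / 2) ^ 2 / (2 * a * w)))
      ≤ |u| ^ k * w ^ j * ((√(c / m) * (√(4 * Real.pi * c * w))⁻¹) *
        (Real.exp (-δ * z ^ 2 + √τ / 2 * z) * Real.exp (-u ^ 2 / (4 * c * w)))) := by
        gcongr
    _ = (√(c / m) * (√(4 * Real.pi * c * w))⁻¹ * Real.exp (-u ^ 2 / (4 * c * w))) *
        ((z ^ k * Real.exp (-δ * z ^ 2 + √τ / 2 * z)) * (√w ^ k * w ^ j)) := by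
        rw [hu, mul_pow]; ring
    _ ≤ (√(c / m) * (√(4 * Real.pi * c * w))⁻¹ * Real.exp (-u ^ 2 / (4 * c * w))) *
        (A * (B * w ^ ((d : ℝ) / 2))) := by
        gcongr
    _ = _ := by ring

lemma gk_nonneg (a w u : ℝ) : 0 ≤ gk a w u := by unfold gk; positivity
lemma hk_nonneg (a w u : ℝ) : 0 ≤ hk a w u := by unfold hk; positivity

lemma GRep.bound {m M ε τ : ℝ} (hm : 0 < m) (hmM : m ≤ M) (hε : 0 < ε) (hτ : 0 < τ)
    (hS : ∀ α ∈ S, m ≤ α 0 / 2) (hS' : ∀ α ∈ S, α 0 / 2 ≤ M) {d : ℤ} {F} (h : GRep S d F) :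
    ∃ C : ℝ, 0 ≤ C ∧ ∀ α ∈ S, ∀ w u : ℝ, 0 < w → w ≤ τ →
      |F α w u * gk (α 0) w u| ≤ C * w ^ ((d : ℝ) / 2) * hk (M + ε) w u := by
  induction h with
  | zero => exact ⟨0, le_rfl, fun α _ w u _ _ => by simp⟩
  | mono c k j B hc h =>
    obtain ⟨C, hC, hb⟩ := bound_mono hm hmM hε hτ k j d h
    refine ⟨|B| * C, by positivity, fun α hα w u hw hwτ => ?_⟩
    have := hb (α 0) w u (hS α hα) (hS' α hα) hw hwτ
    have e : |c α * u ^ k * w ^ j * gk (α 0) w u| = |c α| * (|u| ^ k * w ^ j * gk (α 0) w u) := by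
      rw [abs_mul, abs_mul, abs_mul, abs_pow, abs_of_nonneg (gk_nonneg _ _ _),
        abs_of_pos (zpow_pos hw j)]
      ring
    rw [e]
    calc _ ≤ |B| * (C * w ^ ((d : ℝ) / 2) * hk (M + ε) w u) := by
          apply mul_le_mul ((hc α hα).trans (le_abs_self B)) this _ (abs_nonneg _)
          exact mul_nonneg (mul_nonneg (by positivity) (zpow_pos hw j).le) (gk_nonneg _ _ _)
      _ = _ := by ring
  | add F F' _ _ h1 h2 =>
    obtain ⟨C1, p1, h1⟩ := h1
    obtain ⟨C2, p2, h2⟩ := h2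
    refine ⟨C1 + C2, by positivity, fun α hα w u hw hwτ => ?_⟩
    have a1 := h1 α hα w u hw hwτ
    have a2 := h2 α hα w u hw hwτ
    rw [add_mul]
    refine (abs_add_le _ _).trans ((add_le_add a1 a2).trans (le_of_eq (by ring)))

lemma GRep.deriv2 {m : ℝ} (hm : 0 < m) (hS : ∀ α ∈ S, m ≤ α 0 / 2) {d : ℤ} {F}
    (h : GRep S d F) :
    ∃ F1 F2, GRep S (d - 1) F1 ∧ GRep S (d - 2) F2 ∧ ∀ α ∈ S, ∀ w > 0, ∀ y, ∀ g : ℝ → ℝ,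
      (∀ x, g x = F α w (x - y) * gk (α 0) w (x - y)) → ∀ x,
      _root_.deriv g x = F1 α w (x - y) * gk (α 0) w (x - y) ∧
      iteratedDeriv 2 g x = F2 α w (x - y) * gk (α 0) w (x - y) := by
  obtain ⟨F1, r1, h1⟩ := h.deriv hm hS
  obtain ⟨F2, r2, h2⟩ := r1.deriv hm hS
  refine ⟨F1, F2, r1, r2.le (by linarith), fun α hα w hw y g hg => ?_⟩
  have e1 : _root_.deriv g = fun x => F1 α w (x - y) * gk (α 0) w (x - y) := by
    rw [funext hg]
    funext x
    exact ((h1 α hα w hw (x - y)).comp_sub_const x y).deriv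
  intro x
  refine ⟨congrFun e1 x, ?_⟩
  rw [iteratedDeriv_succ, iteratedDeriv_one, e1]
  exact ((h2 α hα w hw (x - y)).comp_sub_const x y).deriv

lemma gaussK_eq (c t x v y : ℝ) : gaussK c t x v y = gk c (v - t) (x - y) := rfl

lemma heatKer_eq (c t x v y : ℝ) : heatKer c t x v y = hk c (v - t) (x - y) := rfl

lemma main_rep (T : ℝ) (N : ℕ) (m M K : ℝ) (hm : 0 < m) (hS : ∀ α ∈ S, m ≤ α 0 / 2)
    (hS' : ∀ α ∈ S, α 0 / 2 ≤ M) (hSK : ∀ α ∈ S, ∀ k ≤ N, |α k| ≤ K) (n : ℕ) (hn : n ≤ N) :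
    ∃ F, GRep S n F ∧ ∀ α ∈ S, ∀ y : ℝ, ∀ G : ℕ → ℝ → ℝ → ℝ,
        (∀ t x : ℝ, t < T → G 0 t x = gaussK (α 0) t x T y) →
        (∀ n, 1 ≤ n → n ≤ N → ∀ t x : ℝ, t < T →
          G n t x = ∑ h ∈ Finset.Icc 1 n, α h *
            ∫ s in t..T, ∫ η : ℝ, gaussK (α 0) t x s η * (η - y)^h *
              (iteratedDeriv 2 (fun z => G (n - h) s z) η
                - deriv (fun z => G (n - h) s z) η)) →
        ∀ t x : ℝ, t < T → G n t x = F α (T - t) (x - y) * gk (α 0) (T - t) (x - y) := by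
  induction n using Nat.strong_induction_on with
  | _ n ih =>
  rcases Nat.eq_zero_or_pos n with rfl | hpos
  · have r : GRep S ((0 : ℕ) : ℤ) (fun _ _ _ => 1) := by
      simpa using GRep.mono (S := S) 0 (fun _ => 1) 0 0 1 (by simp) (by simp)
    refine ⟨_, r, fun α _ y G h0 _ t x ht => ?_⟩
    rw [h0 t x ht, gaussK_eq, one_mul]
  -- each term of the Duhamel sum
  have key : ∀ h ∈ Finset.Icc 1 n, ∃ F', GRep S n F' ∧ ∀ α ∈ S, ∀ y : ℝ, ∀ G : ℕ → ℝ → ℝ → ℝ,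
        (∀ t x : ℝ, t < T → G 0 t x = gaussK (α 0) t x T y) →
        (∀ n, 1 ≤ n → n ≤ N → ∀ t x : ℝ, t < T →
          G n t x = ∑ h ∈ Finset.Icc 1 n, α h *
            ∫ s in t..T, ∫ η : ℝ, gaussK (α 0) t x s η * (η - y)^h *
              (iteratedDeriv 2 (fun z => G (n - h) s z) η
                - deriv (fun z => G (n - h) s z) η)) →
        ∀ t x : ℝ, t < T →
          (∫ s in t..T, ∫ η : ℝ, gaussK (α 0) t x s η * (η - y)^h *
              (iteratedDeriv 2 (fun z => G (n - h) s z) η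
                - deriv (fun z => G (n - h) s z) η)) =
            F' α (T - t) (x - y) * gk (α 0) (T - t) (x - y) := by
    intro h hh
    obtain ⟨hh1, hh2⟩ := Finset.mem_Icc.1 hh
    obtain ⟨F, r, hF⟩ := ih (n - h) (by omega) (by omega)
    obtain ⟨F1, F2, r1, r2, hD⟩ := r.deriv2 hm hS
    have rr := ((r2.sub (r1.le (by linarith))).mul_pow h)
    obtain ⟨F', r', hF'⟩ := rr.duhamel hm hS hS' (by push_cast [Nat.cast_sub hh2]; omega)
    refine ⟨F', r'.le (by push_cast [Nat.cast_sub hh2]; omega), fun α hα y G h0 hrec t x ht => ?_⟩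
    have hG := hF α hα y G h0 hrec
    have hσ : 0 < T - t := sub_pos.2 ht
    obtain ⟨-, -, e3⟩ := hF' α hα (T - t) hσ (x - y)
    rw [← e3, ← integral_Ioc_eq_integral_Ioo, ← intervalIntegral.integral_of_le hσ.le]
    have := intervalIntegral.integral_comp_sub_left (a := t) (b := T) (fun w => ∫ v, gk (α 0) (T - t - w) (x - y - v) *
      (v ^ h * (F2 α w v - F1 α w v) * gk (α 0) w v)) T
    rw [sub_self] at this
    rw [← this, intervalIntegral.integral_of_le ht.le, intervalIntegral.integral_of_le ht.le,
      integral_Ioc_eq_integral_Ioo, integral_Ioc_eq_integral_Ioo]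
    refine setIntegral_congr_fun measurableSet_Ioo fun s hs => ?_
    beta_reduce
    have hs' : 0 < T - s := sub_pos.2 hs.2
    refine Eq.trans ?_ (integral_sub_right_eq_self _ y)
    congr 1
    funext η
    obtain ⟨d1, d2⟩ := hD α hα (T - s) hs' y (fun z => G (n - h) s z) (fun z => hG s z hs.2) η
    rw [d1, d2, gaussK_eq, show T - t - (T - s) = s - t by ring,
      show x - y - (η - y) = x - η by ring]
    ring
  choose! F' r' hF' using key
  refine ⟨fun α w u => ∑ h ∈ Finset.Icc 1 n, α h * F' h α w u,
    GRep.sum _ (fun h α w u => α h * F' h α w u) fun h hh => (r' h hh).smul (fun α => α h) K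
      fun α hα => hSK α hα h ((Finset.mem_Icc.1 hh).2.trans hn), ?_⟩
  intro α hα y G h0 hrec t x ht
  rw [hrec n hpos hn t x ht, Finset.sum_mul]
  refine Finset.sum_congr rfl fun h hh => ?_
  rw [hF' h hh α hα y G h0 hrec t x ht]
  ring

/-- **Gaussian bounds on the terms of the adjoint expansion** (time-homogeneous, purely
diffusive case, `r = 0`, basepoint `x̄ = y`): for some constant `C`, depending only on
`ε, τ, m, M, N, K`, one has
`|∂_{xx} Gⁿ(t,x;T,y)| ≤ C (T-t)^{(n-2)/2} Γ̄^{M+ε}(t,x;T,y)` for all `n ≤ N` and `0 < T-t ≤ τ`. -/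
theorem adjoint_expansion_gaussian_bounds
    (T : ℝ) (hT : 0 < T) (N : ℕ)
    (m M K ε τ : ℝ) (hm : 0 < m) (hmM : m ≤ M) (hK : 0 ≤ K)
    (hε : 0 < ε) (hτ : 0 < τ) :
    ∃ C > (0:ℝ),
      ∀ α : ℕ → ℝ, m ≤ α 0 / 2 → α 0 / 2 ≤ M → (∀ k ≤ N, |α k| ≤ K) →
      ∀ y : ℝ, ∀ G : ℕ → ℝ → ℝ → ℝ,   -- `G n t x = Gⁿ(t,x;T,y)`, basepoint `x̄ = y`
        (∀ t x : ℝ, t < T → G 0 t x = gaussK (α 0) t x T y) →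
        (∀ n, 1 ≤ n → n ≤ N → ∀ t x : ℝ, t < T →
          G n t x = ∑ h ∈ Finset.Icc 1 n, α h *
            ∫ s in t..T, ∫ η : ℝ, gaussK (α 0) t x s η * (η - y)^h *
              (iteratedDeriv 2 (fun z => G (n - h) s z) η
                - deriv (fun z => G (n - h) s z) η)) →
      ∀ n ≤ N, ∀ x t : ℝ, 0 < T - t → T - t ≤ τ →
        |iteratedDeriv 2 (fun z => G n t z) x|
          ≤ C * (T - t) ^ (((n : ℝ) - 2) / 2) * heatKer (M + ε) t x T y := by
  set S : Set (ℕ → ℝ) := {α | m ≤ α 0 / 2 ∧ α 0 / 2 ≤ M ∧ ∀ k ≤ N, |α k| ≤ K} with hSdef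
  have hS : ∀ α ∈ S, m ≤ α 0 / 2 := fun α h => h.1
  have hS' : ∀ α ∈ S, α 0 / 2 ≤ M := fun α h => h.2.1
  have hSK : ∀ α ∈ S, ∀ k ≤ N, |α k| ≤ K := fun α h => h.2.2
  have key : ∀ n ≤ N, ∃ C : ℝ, 0 ≤ C ∧ ∀ α ∈ S, ∀ y : ℝ, ∀ G : ℕ → ℝ → ℝ → ℝ,
        (∀ t x : ℝ, t < T → G 0 t x = gaussK (α 0) t x T y) →
        (∀ n, 1 ≤ n → n ≤ N → ∀ t x : ℝ, t < T →
          G n t x = ∑ h ∈ Finset.Icc 1 n, α h *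
            ∫ s in t..T, ∫ η : ℝ, gaussK (α 0) t x s η * (η - y)^h *
              (iteratedDeriv 2 (fun z => G (n - h) s z) η
                - deriv (fun z => G (n - h) s z) η)) →
      ∀ x t : ℝ, 0 < T - t → T - t ≤ τ →
        |iteratedDeriv 2 (fun z => G n t z) x|
          ≤ C * (T - t) ^ (((n : ℝ) - 2) / 2) * heatKer (M + ε) t x T y := by
    intro n hn
    obtain ⟨F, r, hF⟩ := main_rep T N m M K hm hS hS' hSK n hn
    obtain ⟨F1, F2, -, r2, hD⟩ := r.deriv2 hm hS
    obtain ⟨C, hC, hb⟩ := r2.bound hm hmM hε hτ hS hS'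
    refine ⟨C, hC, fun α hα y G h0 hrec x t h1 h2 => ?_⟩
    have ht : t < T := sub_pos.1 h1
    rw [(hD α hα (T - t) h1 y (fun z => G n t z) (fun z => hF α hα y G h0 hrec t z ht) x).2]
    have := hb α hα (T - t) (x - y) h1 h2
    push_cast at this
    exact this
  choose! C hC hb using key
  have hsum : 0 ≤ ∑ n ∈ Finset.range (N + 1), C n :=
    Finset.sum_nonneg fun n hn => hC n (Nat.lt_succ_iff.1 (Finset.mem_range.1 hn))
  refine ⟨∑ n ∈ Finset.range (N + 1), C n + 1, by linarith,
    fun α a1 a2 a3 y G h0 hrec n hn x t h1 h2 => ?_⟩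
  refine (hb n hn α ⟨a1, a2, a3⟩ y G h0 hrec x t h1 h2).trans ?_
  have hle : C n ≤ ∑ n ∈ Finset.range (N + 1), C n + 1 := by
    have := Finset.single_le_sum (f := C)
      (fun n hn => hC n (Nat.lt_succ_iff.1 (Finset.mem_range.1 hn)))
      (Finset.mem_range.2 (Nat.lt_succ_iff.2 hn))
    linarith
  have hk0 : 0 ≤ heatKer (M + ε) t x T y := hk_nonneg _ _ _
  gcongr


end
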